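/- arXiv:1402.5453 — 3 statements merged into one kernel-verified Lean document; each statement's English description precedes it below -/
import Mathlib

section
/- Let M be a real symmetric positive definite 2×2 matrix, let J be a real 2×2 matrix with det J > 0, and let θ > 0. If the equidistribution condition √(det M)·det J = θ holds together with the alignment condition tr(Jᵀ M J) = 2·det(Jᵀ M J)^{1/2}, then Jᵀ M J = θ·I. -/
open Matrix

/-- A real symmetric 2×2 matrix with trace `2θ` and determinant `θ²` is `θ • 1`. -/
theorem Matrix.IsSymm.eq_smul_one_of_trace_of_det {A : Matrix (Fin 2) (Fin 2) ℝ}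
    (hA : A.IsSymm) {θ : ℝ} (htr : A.trace = 2 * θ) (hdet : A.det = θ ^ 2) :
    A = θ • (1 : Matrix (Fin 2) (Fin 2) ℝ) := by
  have hs : A 1 0 = A 0 1 := hA.apply 0 1
  rw [trace_fin_two] at htr
  rw [det_fin_two, hs] at hdet
  have hsum : (A 0 0 - θ) ^ 2 + A 0 1 ^ 2 = 0 := by
    linear_combination A 0 0 * htr - hdet
  have hdiag : A 0 0 = θ := by
    have : (A 0 0 - θ) ^ 2 = 0 := by linarith [sq_nonneg (A 0 0 - θ), sq_nonneg (A 0 1)]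
    exact sub_eq_zero.mp (pow_eq_zero_iff two_ne_zero |>.mp this)
  have hoff : A 0 1 = 0 := by simpa [hdiag] using hsum
  have hdiag' : A 1 1 = θ := by linarith
  ext i j
  fin_cases i <;> fin_cases j <;> simp [hdiag, hdiag', hoff, hs]

/-- If `M` is a symmetric positive definite 2×2 matrix, `J` is a 2×2 matrix with
`det J > 0`, and `θ > 0`, then the equidistribution condition
`√(det M)·det J = θ` together with the alignment condition
`tr(Jᵀ M J) = 2·det(Jᵀ M J)^{1/2}` imply `Jᵀ M J = θ·I`. -/
theorem stmt_1 (M J : Matrix (Fin 2) (Fin 2) ℝ) (hM : M.PosDef) (hJ : 0 < J.det)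
    (θ : ℝ) (hθ : 0 < θ)
    (heq : Real.sqrt M.det * J.det = θ)
    (hal : (Jᵀ * M * J).trace = 2 * Real.sqrt (Jᵀ * M * J).det) :
    Jᵀ * M * J = θ • (1 : Matrix (Fin 2) (Fin 2) ℝ) := by
  have hdet : (Jᵀ * M * J).det = θ ^ 2 := by
    rw [det_mul, det_mul, det_transpose, ← heq, mul_pow, Real.sq_sqrt hM.det_pos.le]
    ring
  have hsymm : (Jᵀ * M * J).IsSymm := by
    have hMT : Mᵀ = M := by simpa using hM.isHermitian.eq
    simp [IsSymm, transpose_mul, hMT, Matrix.mul_assoc]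
  rw [hdet, Real.sqrt_sq hθ.le] at hal
  exact hsymm.eq_smul_one_of_trace_of_det hal hdet
end

section
/- Let a, b ∈ ℝ with a² + b² = 1, and set e₁ = (a, b), e₂ = (−b, a). Let ρ₁, ρ₂ : ℝ → ℝ be continuous and 1-periodic, and suppose that the function g(x) := ρ₁(x·e₁)·ρ₂(x·e₂) on ℝ² satisfies g(x + k) = g(x) for all k ∈ ℤ². Then ∫_{[0,1]²} g(x) dx = θ₁·θ₂, where θ₁ = ∫₀¹ ρ₁(s) ds and θ₂ = ∫₀¹ ρ₂(s) ds. -/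
open MeasureTheory

theorem integral_Icc_comp_const_add_of_periodic {f : ℝ → ℝ} (hf : Function.Periodic f 1) (c : ℝ) :
    ∫ x in Set.Icc (0 : ℝ) 1, f (c + x) = ∫ x in (0 : ℝ)..1, f x := by
  rw [integral_Icc_eq_integral_Ioc, ← intervalIntegral.integral_of_le zero_le_one,
    intervalIntegral.integral_comp_add_left]
  simpa using hf.intervalIntegral_add_eq c 0

theorem integral_Icc_comp_const_add_of_doublyPeriodic {g : ℝ × ℝ → ℝ} (hg : Continuous g)
    (hper : ∀ (p : ℝ × ℝ) (k : ℤ × ℤ), g (p.1 + k.1, p.2 + k.2) = g p) (c : ℝ × ℝ) :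
    ∫ p in Set.Icc ((0 : ℝ), (0 : ℝ)) (1, 1), g (c + p) =
      ∫ x in (0 : ℝ)..1, ∫ y in (0 : ℝ)..1, g (x, y) := by
  have hint : IntegrableOn (fun p ↦ g (c + p)) (Set.Icc (0 : ℝ) 1 ×ˢ Set.Icc (0 : ℝ) 1) :=
    (hg.comp (continuous_const.add continuous_id)).continuousOn.integrableOn_compact
      (isCompact_Icc.prod isCompact_Icc)
  have hsnd (x : ℝ) : Function.Periodic (fun y ↦ g (x, y)) 1 := fun y ↦ by
    simpa using hper (x, y) (0, 1)
  have hfst : Function.Periodic (fun x ↦ ∫ y in (0 : ℝ)..1, g (x, y)) 1 := fun x ↦ by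
    refine intervalIntegral.integral_congr fun y _ ↦ ?_
    simpa using hper (x, y) (1, 0)
  rw [← Set.Icc_prod_Icc, Measure.volume_eq_prod, setIntegral_prod _ hint,
    ← integral_Icc_comp_const_add_of_periodic hfst c.1]
  refine integral_congr_ae (.of_forall fun x ↦ ?_)
  exact integral_Icc_comp_const_add_of_periodic (hsnd (c.1 + x)) c.2

/-- For `a² + b² = 1`, `e₁ = (a,b)`, `e₂ = (−b,a)`, continuous 1-periodic
`ρ₁, ρ₂ : ℝ → ℝ`, and `g(x) = ρ₁(x·e₁)·ρ₂(x·e₂)` doubly 1-periodic on `ℝ²`,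
one has `∫_{[0,1]²} g = θ₁·θ₂` with `θᵢ = ∫₀¹ ρᵢ`. -/
theorem stmt_6 (a b : ℝ) (hab : a ^ 2 + b ^ 2 = 1)
    (ρ₁ ρ₂ : ℝ → ℝ) (hc₁ : Continuous ρ₁) (hc₂ : Continuous ρ₂)
    (hp₁ : Function.Periodic ρ₁ 1) (hp₂ : Function.Periodic ρ₂ 1)
    (g : ℝ × ℝ → ℝ)
    (hg : ∀ p : ℝ × ℝ, g p = ρ₁ (p.1 * a + p.2 * b) * ρ₂ (p.1 * (-b) + p.2 * a))
    (hper : ∀ (p : ℝ × ℝ) (k : ℤ × ℤ), g (p.1 + k.1, p.2 + k.2) = g p)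
    (θ₁ θ₂ : ℝ) (hθ₁ : θ₁ = ∫ s in (0:ℝ)..1, ρ₁ s) (hθ₂ : θ₂ = ∫ s in (0:ℝ)..1, ρ₂ s) :
    ∫ p in Set.Icc ((0:ℝ), (0:ℝ)) (1, 1), g p = θ₁ * θ₂ := by
  have hgc : Continuous g := by
    rw [funext hg]
    fun_prop
  set Q := Set.Icc ((0 : ℝ), (0 : ℝ)) (1, 1) with hQ
  have hvol : (volume : Measure (ℝ × ℝ)).real Q = 1 := by
    rw [hQ, ← Set.Icc_prod_Icc, Measure.volume_eq_prod, measureReal_prod_prod]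
    simp
  let r : ℝ × ℝ → ℝ × ℝ := fun q ↦ (q.1 * a - q.2 * b, q.1 * b + q.2 * a)
  have hshift (q : ℝ × ℝ) : ∫ p in Q, g (r q + p) = ∫ p in Q, g p := by
    rw [integral_Icc_comp_const_add_of_doublyPeriodic hgc hper,
      ← integral_Icc_comp_const_add_of_doublyPeriodic hgc hper 0]
    simp only [zero_add, hQ]
  have hrot (p : ℝ × ℝ) : ∫ q in Q, g (r q + p) = θ₁ * θ₂ := by
    have hsplit (q : ℝ × ℝ) : g (r q + p) =
        ρ₁ (p.1 * a + p.2 * b + q.1) * ρ₂ (p.1 * (-b) + p.2 * a + q.2) := by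
      rw [hg]
      congr 2
      · simp only [r, Prod.fst_add, Prod.snd_add]
        linear_combination q.1 * hab
      · simp only [r, Prod.fst_add, Prod.snd_add]
        linear_combination q.2 * hab
    simp only [hsplit]
    rw [hQ, ← Set.Icc_prod_Icc, Measure.volume_eq_prod,
      setIntegral_prod_mul (fun s ↦ ρ₁ (p.1 * a + p.2 * b + s))
        (fun t ↦ ρ₂ (p.1 * (-b) + p.2 * a + t)),
      integral_Icc_comp_const_add_of_periodic hp₁, integral_Icc_comp_const_add_of_periodic hp₂,
      hθ₁, hθ₂]
  have hint : Integrable (Function.uncurry fun q p ↦ g (r q + p))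
      ((volume.restrict Q).prod (volume.restrict Q)) := by
    rw [Measure.prod_restrict]
    refine ContinuousOn.integrableOn_compact (isCompact_Icc.prod isCompact_Icc)
      (Continuous.continuousOn ?_)
    simp only [Function.uncurry_def, r]
    fun_prop
  have hswap := integral_integral_swap hint
  simp only [hshift, hrot] at hswap
  simpa [hvol] using hswap
end

section
/- Let a, b ∈ ℝ with a² + b² = 1, set e₁ = (a, b), e₂ = (−b, a). Let F, G : ℝ → ℝ be twice differentiable, let ρ₁, ρ₂ : ℝ → ℝ, and let θ₁, θ₂ ∈ ℝ. Suppose F″(s)·ρ₁(F′(s)) = θ₁ for all s ∈ ℝ and G″(t)·ρ₂(G′(t)) = θ₂ for all t ∈ ℝ. Then the function P(ξ) = F(ξ·e₁) + G(ξ·e₂) satisfies the Monge–Ampère equation ρ₁(∇P(ξ)·e₁)·ρ₂(∇P(ξ)·e₂)·(P_ξξ P_ηη − P_ξη²)(ξ) = θ₁·θ₂ for all ξ ∈ ℝ². -/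
/-- Derivative of a linear combination of two compositions of one-variable functions. -/
theorem deriv_const_mul_comp_add {f g u v : ℝ → ℝ} (hf : Differentiable ℝ f)
    (hg : Differentiable ℝ g) (c d : ℝ) {u' v' x : ℝ} (hu : HasDerivAt u u' x)
    (hv : HasDerivAt v v' x) :
    deriv (fun t => c * f (u t) + d * g (v t)) x =
      c * u' * deriv f (u x) + d * v' * deriv g (v x) := by
  have h := (((hf (u x)).hasDerivAt.comp x hu).const_mul c).add
    (((hg (v x)).hasDerivAt.comp x hv).const_mul d)
  refine h.deriv.trans ?_
  ring

/-- For `a² + b² = 1`, `e₁ = (a,b)`, `e₂ = (−b,a)`, twice differentiable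
`F, G : ℝ → ℝ` with `F″(s)·ρ₁(F′(s)) = θ₁` and `G″(t)·ρ₂(G′(t)) = θ₂`
everywhere, the potential `P(ξ) = F(ξ·e₁) + G(ξ·e₂)` satisfies the
Monge–Ampère equation
`ρ₁(∇P·e₁)·ρ₂(∇P·e₂)·(P_ξξ P_ηη − P_ξη²) = θ₁·θ₂` at every point. -/
theorem stmt_11 (a b : ℝ) (hab : a ^ 2 + b ^ 2 = 1)
    (F G : ℝ → ℝ)
    (hF : Differentiable ℝ F) (hF' : Differentiable ℝ (deriv F))
    (hG : Differentiable ℝ G) (hG' : Differentiable ℝ (deriv G))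
    (ρ₁ ρ₂ : ℝ → ℝ) (θ₁ θ₂ : ℝ)
    (hode₁ : ∀ s : ℝ, deriv (deriv F) s * ρ₁ (deriv F s) = θ₁)
    (hode₂ : ∀ t : ℝ, deriv (deriv G) t * ρ₂ (deriv G t) = θ₂)
    (P : ℝ → ℝ → ℝ)
    (hP : ∀ ξ η, P ξ η = F (a * ξ + b * η) + G (-b * ξ + a * η)) :
    ∀ ξ η : ℝ,
      ρ₁ (a * deriv (fun t => P t η) ξ + b * deriv (fun t => P ξ t) η) *
      ρ₂ (-b * deriv (fun t => P t η) ξ + a * deriv (fun t => P ξ t) η) *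
      (deriv (fun s => deriv (fun t => P t η) s) ξ *
         deriv (fun s => deriv (fun t => P ξ t) s) η -
         (deriv (fun s => deriv (fun t => P t s) ξ) η) ^ 2) = θ₁ * θ₂ := by
  have hfst : ∀ c d ξ η : ℝ, HasDerivAt (fun t => c * t + d * η) c ξ := fun c d ξ η => by
    simpa using ((hasDerivAt_id ξ).const_mul c).add_const (d * η)
  have hsnd : ∀ c d ξ η : ℝ, HasDerivAt (fun t => c * ξ + d * t) d η := fun c d ξ η => by
    simpa using ((hasDerivAt_id η).const_mul d).const_add (c * ξ)
  have hPξ : ∀ ξ η : ℝ, deriv (fun t => P t η) ξ =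
      a * deriv F (a * ξ + b * η) + -b * deriv G (-b * ξ + a * η) := fun ξ η => by
    simpa [hP] using deriv_const_mul_comp_add hF hG 1 1 (hfst a b ξ η) (hfst (-b) a ξ η)
  have hPη : ∀ ξ η : ℝ, deriv (fun t => P ξ t) η =
      b * deriv F (a * ξ + b * η) + a * deriv G (-b * ξ + a * η) := fun ξ η => by
    simpa [hP] using deriv_const_mul_comp_add hF hG 1 1 (hsnd a b ξ η) (hsnd (-b) a ξ η)
  intro ξ η
  simp only [hPξ, hPη]
  rw [deriv_const_mul_comp_add hF' hG' a (-b) (hfst a b ξ η) (hfst (-b) a ξ η),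
    deriv_const_mul_comp_add hF' hG' b a (hsnd a b ξ η) (hsnd (-b) a ξ η),
    deriv_const_mul_comp_add hF' hG' a (-b) (hsnd a b ξ η) (hsnd (-b) a ξ η),
    ← hode₁ (a * ξ + b * η), ← hode₂ (-b * ξ + a * η)]
  generalize a * ξ + b * η = s
  generalize -b * ξ + a * η = t
  have h₁ : a * (a * deriv F s + -b * deriv G t) + b * (b * deriv F s + a * deriv G t)
      = deriv F s := by
    linear_combination deriv F s * hab
  have h₂ : -b * (a * deriv F s + -b * deriv G t) + a * (b * deriv F s + a * deriv G t)
      = deriv G t := by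
    linear_combination deriv G t * hab
  rw [h₁, h₂]
  linear_combination ρ₁ (deriv F s) * ρ₂ (deriv G t) * deriv (deriv F) s * deriv (deriv G) t *
    (a ^ 2 + b ^ 2 + 1) * hab
end
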